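/- For every rational α with 1/2 < α ≤ 1 and every integer λ ≥ 1 such that k := ⌈λα/(2α−1)⌉ − 1 ≥ 1, there exist an approval profile with m ≥ k alternatives, an Approval Voting ranking r of it, and an (α,λ)-significant group N' ⊆ N such that avg(N', r_{≤k}) < λ. -/

import Mathlib

open Finset

/-- The set of the top `k` alternatives of the ranking `r`
(where `r j` is the alternative at position `j`). -/
def topk {m : ℕ} (r : Fin m ≃ Fin m) (k : ℕ) : Finset (Fin m) :=
  Finset.univ.filter fun a => (r.symm a : ℕ) < k

/-- Average representation of the group `N'` with respect to the set `S`. -/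
def avgRep {n m : ℕ} (App : Fin n → Finset (Fin m)) (N' : Finset (Fin n))
    (S : Finset (Fin m)) : ℚ :=
  (∑ i ∈ N', ((App i ∩ S).card : ℚ)) / (N'.card : ℚ)

/-- `N'` is `(α, λ)`-significant: it has `⌈αn⌉` members and cohesiveness at least `λ`. -/
def Significant {n m : ℕ} (App : Fin n → Finset (Fin m)) (α : ℚ) (lam : ℕ)
    (N' : Finset (Fin n)) : Prop :=
  (N'.card : ℤ) = ⌈α * (n : ℚ)⌉ ∧ lam ≤ (N'.inf App).card

/-- Approval score of alternative `a`. -/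
def approvalScore {n m : ℕ} (App : Fin n → Finset (Fin m)) (a : Fin m) : ℕ :=
  (Finset.univ.filter fun i => a ∈ App i).card

/-- A ranking is an Approval Voting ranking if approval scores are non-increasing
along positions. -/
def IsAVRanking {n m : ℕ} (App : Fin n → Finset (Fin m)) (r : Fin m ≃ Fin m) : Prop :=
  ∀ j j' : Fin m, j ≤ j' → approvalScore App (r j') ≤ approvalScore App (r j)

theorem card_fin_lt_aux (m k : ℕ) (h : k ≤ m) :
    (Finset.univ.filter fun a : Fin m => (a : ℕ) < k).card = k := by
  rw [Fin.card_filter_val_lt]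
  omega

theorem card_fin_ge_aux (m k : ℕ) (h : k ≤ m) :
    (Finset.univ.filter fun a : Fin m => k ≤ (a : ℕ)).card = m - k := by
  have h1 := card_fin_lt_aux m k h
  have h2 := Finset.card_filter_add_card_filter_not (s := (Finset.univ : Finset (Fin m)))
    (fun a : Fin m => (a : ℕ) < k)
  simp only [not_lt, Finset.card_univ, Fintype.card_fin] at h2
  omega

theorem card_fin_Ico_aux (m j k : ℕ) (h : k ≤ m) :
    (Finset.univ.filter fun a : Fin m => (a : ℕ) < k ∧ j ≤ (a : ℕ)).card ≤ k - j := by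
  rw [← Nat.card_Ico j k]
  apply Finset.card_le_card_of_injOn (fun a : Fin m => (a : ℕ))
  · intro a ha
    simp at ha ⊢
    omega
  · intro a _ b _ hab
    exact Fin.ext hab

theorem av_group_representation_lower_bound
    (α : ℚ) (hα1 : 1 / 2 < α) (hα2 : α ≤ 1) (lam : ℕ) (hlam : 1 ≤ lam)
    (k : ℕ) (hk : (k : ℤ) = ⌈(lam : ℚ) * α / (2 * α - 1)⌉ - 1) (hk1 : 1 ≤ k) :
    ∃ (n m : ℕ) (App : Fin n → Finset (Fin m)) (r : Fin m ≃ Fin m)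
      (N' : Finset (Fin n)),
      (∀ i, (App i).Nonempty) ∧ k ≤ m ∧ IsAVRanking App r ∧
      Significant App α lam N' ∧ avgRep App N' (topk r k) < (lam : ℚ) := by
  obtain ⟨p, q, hq, hαq⟩ : ∃ p q : ℕ, 0 < q ∧ α = (p : ℚ) / q := by
    refine ⟨α.num.toNat, α.den, α.den_pos, ?_⟩
    have h0 : 0 ≤ α.num := Rat.num_nonneg.mpr (by linarith)
    have h1 : ((α.num.toNat : ℕ) : ℚ) = (α.num : ℚ) := by
      exact_mod_cast congrArg (Int.cast : ℤ → ℚ) (Int.toNat_of_nonneg h0)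
    rw [h1]
    exact (Rat.num_div_den α).symm
  have hqQ : (0 : ℚ) < q := by exact_mod_cast hq
  have hαn : α * (q : ℚ) = p := by rw [hαq]; field_simp
  have hpq : p ≤ q := by
    have : (p : ℚ) ≤ q := by rw [← hαn]; nlinarith
    exact_mod_cast this
  have hqp : q < 2 * p := by
    have : (q : ℚ) < 2 * p := by rw [← hαn]; nlinarith
    exact_mod_cast this
  have hp : 0 < p := by omega
  have hpQ : (0 : ℚ) < p := by exact_mod_cast hp
  have hkey : (k : ℚ) * (2 * p - q) < lam * p := by
    have h1 : (k : ℤ) < ⌈(lam : ℚ) * α / (2 * α - 1)⌉ := by omega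
    rw [Int.lt_ceil, lt_div_iff₀ (by linarith)] at h1
    have h2 := mul_lt_mul_of_pos_right h1 hqQ
    rw [← hαn]
    push_cast at h2
    nlinarith
  refine ⟨q, k + lam, fun i => Finset.univ.filter fun a =>
    ((a : ℕ) < k ∧ q - p ≤ (i : ℕ)) ∨ (k ≤ (a : ℕ) ∧ (i : ℕ) < p), Equiv.refl _,
    Finset.univ.filter fun i => (i : ℕ) < p, ?_, by omega, ?_, ⟨?_, ?_⟩, ?_⟩
  · intro i
    by_cases hi : (i : ℕ) < p
    · exact ⟨⟨k, by omega⟩, by simp [hi]⟩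
    · exact ⟨⟨0, by omega⟩, by simp; omega⟩
  · have hs : ∀ a : Fin (k + lam), approvalScore (fun i : Fin q => Finset.univ.filter
        fun a : Fin (k + lam) =>
        ((a : ℕ) < k ∧ q - p ≤ (i : ℕ)) ∨ (k ≤ (a : ℕ) ∧ (i : ℕ) < p)) a = p := by
      intro a
      unfold approvalScore
      by_cases ha : (a : ℕ) < k
      · have := card_fin_ge_aux q (q - p) (by omega)
        simp only [Finset.mem_filter, Finset.mem_univ, true_and, ha, not_le.mpr ha, false_and,
          or_false]
        rw [this]; omega
      · simp only [Finset.mem_filter, Finset.mem_univ, true_and, ha, not_lt.mp ha, false_and,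
          false_or]
        exact card_fin_lt_aux q p hpq
    intro j j' _
    rw [hs, hs]
  · rw [card_fin_lt_aux q p hpq, hαn]
    simp
  · have h1 := card_fin_ge_aux (k + lam) k (by omega)
    have h2 : lam = (Finset.univ.filter fun a : Fin (k + lam) => k ≤ (a : ℕ)).card := by omega
    refine h2.le.trans (Finset.card_le_card ?_)
    apply Finset.le_inf
    intro i hi a ha
    simp only [Finset.mem_filter, Finset.mem_univ, true_and] at hi ha ⊢
    exact Or.inr ⟨by omega, hi⟩
  · unfold avgRep
    rw [card_fin_lt_aux q p hpq, div_lt_iff₀ hpQ]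
    refine lt_of_le_of_lt ?_ hkey
    calc _ ≤ ∑ i ∈ Finset.univ.filter (fun i : Fin q => (i : ℕ) < p),
          (if q - p ≤ (i : ℕ) then (k : ℚ) else 0) := by
          apply Finset.sum_le_sum
          intro i hi
          split_ifs with h
          · have hc : (topk (Equiv.refl (Fin (k + lam))) k).card = k :=
              card_fin_lt_aux (k + lam) k (by omega)
            have := Finset.card_le_card (Finset.inter_subset_right (s₁ := Finset.univ.filter
              fun a : Fin (k + lam) => ((a : ℕ) < k ∧ q - p ≤ (i : ℕ)) ∨
                (k ≤ (a : ℕ) ∧ (i : ℕ) < p)) (s₂ := topk (Equiv.refl (Fin (k + lam))) k))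
            rw [hc] at this
            exact_mod_cast this
          · apply le_of_eq
            rw [Nat.cast_eq_zero, Finset.card_eq_zero]
            ext a
            simp only [topk, Finset.mem_inter, Finset.mem_filter, Finset.mem_univ, true_and,
              Equiv.refl_symm, Equiv.refl_apply, Finset.notMem_empty, iff_false]
            rintro ⟨h1, h2⟩
            have h3 : (a : ℕ) < k := (Finset.mem_filter.mp h2).2
            omega
      _ ≤ _ := by
          rw [← Finset.sum_filter, Finset.sum_const, Finset.filter_filter, nsmul_eq_mul, mul_comm]
          apply mul_le_mul_of_nonneg_left _ (Nat.cast_nonneg k)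
          have h1 := card_fin_Ico_aux q (q - p) p hpq
          have h2 : (Finset.univ.filter fun a : Fin q =>
            (a : ℕ) < p ∧ q - p ≤ (a : ℕ)).card + q ≤ 2 * p := by omega
          have h3 : (((Finset.univ.filter fun a : Fin q =>
            (a : ℕ) < p ∧ q - p ≤ (a : ℕ)).card : ℕ) : ℚ) + q ≤ 2 * p := by exact_mod_cast h2
          linarith
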